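/- For all t ∈ ℕ and all x ∈ 𝒳, the iterates of the dynamics satisfy F(x, Y_t) − F(x, Y_0) ≤ Σ_{τ=0}^{t−1} γ_τ ⟨X_τ − x, v(X_τ)⟩ − Σ_{τ=0}^{t−1} γ_τ β_τ ⟨X_τ − x, Aᵀ Λ_τ⟩ + Σ_{τ=0}^{t−1} (β_τ² γ_τ² C₁²/K) ‖Λ_τ‖₂² + S_t(x) + (2/K) R_t + (2 C₂²/K) Σ_{τ=0}^{t−1} γ_τ², where S_t(x) = Σ_{τ=0}^{t−1} γ_τ ⟨X_τ − x, ξ_{τ+1}⟩ and R_t = Σ_{τ=0}^{t−1} γ_τ² ‖ξ_{τ+1}‖_*². -/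

import Mathlib

open scoped Matrix
open Finset

/-- The standard inner product on the product space ∏ᵢ ℝ^{Dᵢ}. -/
def gInner {N : ℕ} {Dd : Fin N → ℕ} (x y : (i : Fin N) → Fin (Dd i) → ℝ) : ℝ :=
  ∑ i, x i ⬝ᵥ y i

/-- The dual norm ‖y‖_* = sup{⟨y,x⟩ : ‖x‖ ≤ 1} of a norm `nrm` on ℝ^n. -/
noncomputable def dualN {n : ℕ} (nrm : (Fin n → ℝ) → ℝ) (y : Fin n → ℝ) : ℝ :=
  sSup {r : ℝ | ∃ x : Fin n → ℝ, nrm x ≤ 1 ∧ r = y ⬝ᵥ x}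

/-- The dual norm ‖y‖_* = (Σᵢ ‖y⁽ⁱ⁾‖_{i,*}²)^{1/2} on the product space ∏ᵢ ℝ^{Dᵢ}. -/
noncomputable def gDualN {N : ℕ} {Dd : Fin N → ℕ} (nrm : ∀ i, (Fin (Dd i) → ℝ) → ℝ)
    (y : (i : Fin N) → Fin (Dd i) → ℝ) : ℝ :=
  Real.sqrt (∑ i, dualN (nrm i) (y i) ^ 2)

theorem exists_linear_le_mul_norm {E : Type*} [AddCommGroup E] [Module ℝ E]
    [FiniteDimensional ℝ E] (nrm : E → ℝ) (h0 : ∀ x, nrm x = 0 ↔ x = 0)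
    (hS : ∀ (c : ℝ) x, nrm (c • x) = |c| * nrm x)
    (hT : ∀ x y, nrm (x + y) ≤ nrm x + nrm y) (f : E →ₗ[ℝ] ℝ) :
    ∃ C, 0 ≤ C ∧ ∀ x, f x ≤ C * nrm x := by
  let g : AddGroupNorm E :=
    { toFun := nrm
      map_zero' := (h0 0).2 rfl
      add_le' := hT
      neg' := fun x => by simpa using hS (-1) x
      eq_zero_of_map_eq_zero' := fun x hx => (h0 x).1 hx }
  let _ : NormedAddCommGroup E := g.toNormedAddCommGroup
  let _ : NormedSpace ℝ E := ⟨fun c x => (hS c x).le⟩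
  exact ⟨‖f.toContinuousLinearMap‖, norm_nonneg _, fun x =>
    (le_abs_self _).trans (f.toContinuousLinearMap.le_opNorm x)⟩

theorem dotProduct_le_dualN_mul {n : ℕ} (nrm : (Fin n → ℝ) → ℝ)
    (h0 : ∀ x, nrm x = 0 ↔ x = 0) (hS : ∀ (c : ℝ) x, nrm (c • x) = |c| * nrm x)
    (hT : ∀ x y, nrm (x + y) ≤ nrm x + nrm y) (y x : Fin n → ℝ) :
    y ⬝ᵥ x ≤ dualN nrm y * nrm x := by
  obtain ⟨C, hC, hb⟩ := exists_linear_le_mul_norm nrm h0 hS hT (dotProductBilin ℝ ℝ y)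
  have hbdd : BddAbove {r : ℝ | ∃ x : Fin n → ℝ, nrm x ≤ 1 ∧ r = y ⬝ᵥ x} := by
    refine ⟨C, ?_⟩
    rintro r ⟨z, hz, rfl⟩
    exact (hb z).trans (mul_le_of_le_one_right hC hz)
  have hneg : nrm (-x) = nrm x := by simpa using hS (-1) x
  have hnn : 0 ≤ nrm x := by
    have h := hT x (-x)
    rw [add_neg_cancel, (h0 0).2 rfl, hneg] at h
    linarith
  rcases hnn.eq_or_lt with h | h
  · have : x = 0 := (h0 x).1 h.symm
    simp [this, (h0 0).2 rfl]
  · have hle : y ⬝ᵥ ((nrm x)⁻¹ • x) ≤ dualN nrm y := by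
      refine le_csSup hbdd ⟨_, ?_, rfl⟩
      rw [hS, abs_of_pos (inv_pos.2 h), inv_mul_cancel₀ h.ne']
    rw [dotProduct_smul, smul_eq_mul, inv_mul_le_iff₀ h] at hle
    linarith

/-- Quadratic growth below a maximizer of a strongly concave function `⟨y, ·⟩ - ψ`. -/
theorem IsMaxOn.add_sq_le_of_strongConvex {n : ℕ} {s : Set (Fin n → ℝ)} (hs : Convex ℝ s)
    {nrm ψ : (Fin n → ℝ) → ℝ} {κ : ℝ} (hκ : 0 ≤ κ)
    (hψ : ∀ x ∈ s, ∀ y ∈ s, ∀ t ∈ Set.Icc (0 : ℝ) 1,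
      ψ (t • x + (1 - t) • y) ≤ t * ψ x + (1 - t) * ψ y
        - κ / 2 * t * (1 - t) * nrm (x - y) ^ 2)
    {y p q : Fin n → ℝ} (hp : p ∈ s) (hq : q ∈ s)
    (hmax : IsMaxOn (fun x => y ⬝ᵥ x - ψ x) s p) :
    y ⬝ᵥ q - ψ q + κ / 2 * nrm (q - p) ^ 2 ≤ y ⬝ᵥ p - ψ p := by
  set c := κ / 2 * nrm (q - p) ^ 2 with hc
  have hc0 : 0 ≤ c := by positivity
  refine le_of_forall_pos_le_add fun ε hε => ?_
  set t := ε / (c + ε) with ht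
  have ht0 : 0 < t := by positivity
  have ht1 : t ≤ 1 := (div_le_one (by positivity)).2 (by linarith)
  have htc : c * t ≤ ε := by
    rw [ht, mul_div_assoc', div_le_iff₀ (by positivity)]
    nlinarith
  have h1 := hψ q hq p hp t ⟨ht0.le, ht1⟩
  have h2 : y ⬝ᵥ (t • q + (1 - t) • p) - ψ (t • q + (1 - t) • p) ≤ y ⬝ᵥ p - ψ p :=
    hmax (hs hq hp ht0.le (by linarith) (by ring))
  simp only [dotProduct_add, dotProduct_smul, smul_eq_mul] at h2
  have h3 : t * (y ⬝ᵥ q - ψ q + c * (1 - t)) ≤ t * (y ⬝ᵥ p - ψ p) := by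
    rw [hc]
    linarith
  have h4 := le_of_mul_le_mul_left h3 ht0
  linarith

theorem mul_le_sq_div_add_sq {k : ℝ} (hk : 0 < k) (a d : ℝ) :
    a * d ≤ a ^ 2 / k + k / 4 * d ^ 2 := by
  have h : a ^ 2 / k + k / 4 * d ^ 2 - a * d = (a - k / 2 * d) ^ 2 / k := by
    field_simp
    ring
  have : 0 ≤ (a - k / 2 * d) ^ 2 / k := by positivity
  linarith

theorem gDualN_sq {N : ℕ} {Dd : Fin N → ℕ} (nrm : ∀ i, (Fin (Dd i) → ℝ) → ℝ)
    (y : (i : Fin N) → Fin (Dd i) → ℝ) :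
    gDualN nrm y ^ 2 = ∑ i, dualN (nrm i) (y i) ^ 2 :=
  Real.sq_sqrt (Finset.sum_nonneg fun _ _ => sq_nonneg _)

/-- One mirror step along `g (a + e - β w)` changes the Fenchel coupling at `x` by at most its
linear part plus the squared dual norms of the three components. -/
theorem fenchelCoupling_step_le {n : ℕ} {s : Set (Fin n → ℝ)} (hs : Convex ℝ s)
    {nrm ψ : (Fin n → ℝ) → ℝ} (h0 : ∀ x, nrm x = 0 ↔ x = 0)
    (hS : ∀ (c : ℝ) x, nrm (c • x) = |c| * nrm x)
    (hT : ∀ x y, nrm (x + y) ≤ nrm x + nrm y) {K κ : ℝ} (hK : 0 < K) (hKκ : K ≤ κ)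
    (hψ : ∀ x ∈ s, ∀ y ∈ s, ∀ t ∈ Set.Icc (0 : ℝ) 1,
      ψ (t • x + (1 - t) • y) ≤ t * ψ x + (1 - t) * ψ y
        - κ / 2 * t * (1 - t) * nrm (x - y) ^ 2)
    {y p q a e w x : Fin n → ℝ} (hp : p ∈ s) (hq : q ∈ s)
    (hmax : IsMaxOn (fun x => y ⬝ᵥ x - ψ x) s p) {g β : ℝ} (hg : 0 ≤ g) (hβ : 0 ≤ β) :
    (ψ x + ((y + g • (a + e - β • w)) ⬝ᵥ q - ψ q) - (y + g • (a + e - β • w)) ⬝ᵥ x)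
      - (ψ x + (y ⬝ᵥ p - ψ p) - y ⬝ᵥ x) ≤
    g * ((p - x) ⬝ᵥ a) - g * β * ((p - x) ⬝ᵥ w) + β ^ 2 * g ^ 2 / K * dualN nrm w ^ 2
      + g * ((p - x) ⬝ᵥ e) + 2 / K * (g ^ 2 * dualN nrm e ^ 2)
      + 2 / K * g ^ 2 * dualN nrm a ^ 2 := by
  have hgrow := hmax.add_sq_le_of_strongConvex hs (hK.le.trans hKκ) hψ hp hq
  have hsq : K / 2 * nrm (q - p) ^ 2 ≤ κ / 2 * nrm (q - p) ^ 2 := by gcongr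
  have hneg : nrm (p - q) = nrm (q - p) := by simpa using hS (-1) (q - p)
  have ha := mul_le_mul_of_nonneg_left (dotProduct_le_dualN_mul nrm h0 hS hT a (q - p)) hg
  have he := mul_le_mul_of_nonneg_left (dotProduct_le_dualN_mul nrm h0 hS hT e (q - p)) hg
  have hw := mul_le_mul_of_nonneg_left (dotProduct_le_dualN_mul nrm h0 hS hT w (p - q))
    (mul_nonneg hg hβ)
  rw [hneg] at hw
  have ha' := mul_le_sq_div_add_sq (half_pos hK) (g * dualN nrm a) (nrm (q - p))
  have he' := mul_le_sq_div_add_sq (half_pos hK) (g * dualN nrm e) (nrm (q - p))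
  have hw' := mul_le_sq_div_add_sq hK (g * β * dualN nrm w) (nrm (q - p))
  have e1 : (g * dualN nrm a) ^ 2 / (K / 2) = 2 / K * g ^ 2 * dualN nrm a ^ 2 := by
    field_simp
  have e2 : (g * dualN nrm e) ^ 2 / (K / 2) = 2 / K * (g ^ 2 * dualN nrm e ^ 2) := by
    field_simp
  have e3 : (g * β * dualN nrm w) ^ 2 / K = β ^ 2 * g ^ 2 / K * dualN nrm w ^ 2 := by
    field_simp
  rw [e1] at ha'
  rw [e2] at he'
  rw [e3] at hw'
  simp only [dotProduct_comm (p - x)]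
  simp only [add_dotProduct, sub_dotProduct, smul_dotProduct, dotProduct_sub, smul_eq_mul]
    at ha he hw ⊢
  linarith

/-- **Cumulative Fenchel-coupling bound along the controlled OMD dynamics (Lemma 1).**
For all t ∈ ℕ and all x ∈ 𝒳 = ∏ᵢ𝒳ᵢ:
F(x,Y_t) − F(x,Y_0) ≤ Σ_{τ<t} γ_τ⟨X_τ − x, v(X_τ)⟩ − Σ_{τ<t} γ_τβ_τ⟨X_τ − x, AᵀΛ_τ⟩
 + Σ_{τ<t} (β_τ²γ_τ²C₁²/K)‖Λ_τ‖₂² + S_t(x) + (2/K)R_t + (2C₂²/K)Σ_{τ<t}γ_τ²,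
where S_t(x) = Σ_{τ<t} γ_τ⟨X_τ − x, ξ_{τ+1}⟩ and R_t = Σ_{τ<t} γ_τ²‖ξ_{τ+1}‖_*².
(Here ‖·‖₂² = ⟨·,·⟩.) -/
theorem stmt3 {N R : ℕ} (Dd : Fin N → ℕ)
    -- the agents' action sets 𝒳ᵢ: nonempty, compact, convex
    (Xset : ∀ i, Set (Fin (Dd i) → ℝ))
    (hXne : ∀ i, (Xset i).Nonempty) (hXcomp : ∀ i, IsCompact (Xset i))
    (hXconv : ∀ i, Convex ℝ (Xset i))
    -- the agents' norms ‖·‖ᵢ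
    (nrm : ∀ i, (Fin (Dd i) → ℝ) → ℝ)
    (hnrm0 : ∀ i x, nrm i x = 0 ↔ x = 0)
    (hnrmS : ∀ i (c : ℝ) x, nrm i (c • x) = |c| * nrm i x)
    (hnrmT : ∀ i x y, nrm i (x + y) ≤ nrm i x + nrm i y)
    -- the regularizers ψᵢ: continuous and Kᵢ-strongly convex; K = minᵢ Kᵢ
    (Ks : Fin N → ℝ) (hKs : ∀ i, 0 < Ks i) (K : ℝ) (hK : IsLeast (Set.range Ks) K)
    (ψ : ∀ i, (Fin (Dd i) → ℝ) → ℝ) (hψcont : ∀ i, ContinuousOn (ψ i) (Xset i))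
    (hψsc : ∀ i, ∀ x ∈ Xset i, ∀ y ∈ Xset i, ∀ t ∈ Set.Icc (0 : ℝ) 1,
      ψ i (t • x + (1 - t) • y) ≤ t * ψ i x + (1 - t) * ψ i y
        - Ks i / 2 * t * (1 - t) * nrm i (x - y) ^ 2)
    -- the mirror maps Φᵢ and the total Fenchel coupling F
    (Φ : ∀ i, (Fin (Dd i) → ℝ) → (Fin (Dd i) → ℝ))
    (hΦmem : ∀ i y, Φ i y ∈ Xset i)
    (hΦmax : ∀ i y, IsMaxOn (fun x => y ⬝ᵥ x - ψ i x) (Xset i) (Φ i y))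
    (F : ((i : Fin N) → Fin (Dd i) → ℝ) → ((i : Fin N) → Fin (Dd i) → ℝ) → ℝ)
    (hF : ∀ x y, F x y = ∑ i,
      (ψ i (x i) + (y i ⬝ᵥ Φ i (y i) - ψ i (Φ i (y i))) - y i ⬝ᵥ x i))
    -- the gradient map v, the resource matrix A (as a linear map), its transpose At, capacity b
    (v : ((i : Fin N) → Fin (Dd i) → ℝ) → ((i : Fin N) → Fin (Dd i) → ℝ))
    (A : ((i : Fin N) → Fin (Dd i) → ℝ) →ₗ[ℝ] (Fin R → ℝ))
    (At : (Fin R → ℝ) →ₗ[ℝ] ((i : Fin N) → Fin (Dd i) → ℝ))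
    (hadj : ∀ x lam, A x ⬝ᵥ lam = gInner x (At lam))
    (b : Fin R → ℝ)
    -- the constants C₁, C₂, C₃
    (C₁ C₂ C₃ : ℝ) (hC₁0 : 0 ≤ C₁) (hC₂0 : 0 ≤ C₂) (hC₃0 : 0 ≤ C₃)
    (hC₁ : ∀ lam : Fin R → ℝ, (∀ r, 0 ≤ lam r) →
      gDualN nrm (At lam) ≤ C₁ * Real.sqrt (lam ⬝ᵥ lam))
    (hC₂ : ∀ x, (∀ i, x i ∈ Xset i) → gDualN nrm (v x) ≤ C₂)
    (hC₃ : ∀ x, (∀ i, x i ∈ Xset i) →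
      Real.sqrt ((A x - b) ⬝ᵥ (A x - b)) ≤ C₃)
    -- the step sizes, price progressivity and price sensitivity
    (γ ζ η β : ℕ → ℝ)
    (hγ : ∀ τ, 0 < γ τ) (hζ : ∀ τ, ζ τ ∈ Set.Ioo (0 : ℝ) 1)
    (hη : ∀ τ, 0 ≤ η τ) (hβ : ∀ τ, 0 ≤ β τ)
    -- the dynamics
    (ξ : ℕ → (i : Fin N) → Fin (Dd i) → ℝ)
    (Y : ℕ → (i : Fin N) → Fin (Dd i) → ℝ)
    (Λ : ℕ → Fin R → ℝ) (hΛ0 : ∀ r, 0 ≤ Λ 0 r)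
    (X : ℕ → (i : Fin N) → Fin (Dd i) → ℝ)
    (hX : ∀ τ i, X τ i = Φ i (Y τ i))
    (hY : ∀ τ, Y (τ + 1) = Y τ + γ τ • (v (X τ) + ξ (τ + 1) - β τ • At (Λ τ)))
    (hΛ : ∀ τ r, Λ (τ + 1) r = max ((1 - η τ) * Λ τ r + ζ τ * (A (X τ) - b) r) 0) :
    ∀ (t : ℕ) (x : (i : Fin N) → Fin (Dd i) → ℝ), (∀ i, x i ∈ Xset i) →
      F x (Y t) - F x (Y 0) ≤
        (∑ τ ∈ range t, γ τ * gInner (X τ - x) (v (X τ)))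
        - (∑ τ ∈ range t, γ τ * β τ * gInner (X τ - x) (At (Λ τ)))
        + (∑ τ ∈ range t, β τ ^ 2 * γ τ ^ 2 * C₁ ^ 2 / K * (Λ τ ⬝ᵥ Λ τ))
        + (∑ τ ∈ range t, γ τ * gInner (X τ - x) (ξ (τ + 1)))
        + 2 / K * (∑ τ ∈ range t, γ τ ^ 2 * gDualN nrm (ξ (τ + 1)) ^ 2)
        + 2 * C₂ ^ 2 / K * (∑ τ ∈ range t, γ τ ^ 2) := by
  intro t x hx
  have hKle : ∀ i, K ≤ Ks i := fun i => hK.2 ⟨i, rfl⟩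
  have hKpos : 0 < K := by
    obtain ⟨i, hi⟩ := hK.1
    exact hi ▸ hKs i
  have hΛnn : ∀ τ r, 0 ≤ Λ τ r := by
    rintro (_ | τ) r
    · exact hΛ0 r
    · rw [hΛ]
      exact le_max_right _ _
  have hstep : ∀ τ, F x (Y (τ + 1)) - F x (Y τ) ≤
      γ τ * gInner (X τ - x) (v (X τ)) - γ τ * β τ * gInner (X τ - x) (At (Λ τ))
        + β τ ^ 2 * γ τ ^ 2 * C₁ ^ 2 / K * (Λ τ ⬝ᵥ Λ τ)
        + γ τ * gInner (X τ - x) (ξ (τ + 1))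
        + 2 / K * (γ τ ^ 2 * gDualN nrm (ξ (τ + 1)) ^ 2)
        + 2 * C₂ ^ 2 / K * γ τ ^ 2 := by
    intro τ
    have hmain : F x (Y (τ + 1)) - F x (Y τ) ≤
        γ τ * gInner (X τ - x) (v (X τ)) - γ τ * β τ * gInner (X τ - x) (At (Λ τ))
          + β τ ^ 2 * γ τ ^ 2 / K * gDualN nrm (At (Λ τ)) ^ 2
          + γ τ * gInner (X τ - x) (ξ (τ + 1))
          + 2 / K * (γ τ ^ 2 * gDualN nrm (ξ (τ + 1)) ^ 2)
          + 2 / K * γ τ ^ 2 * gDualN nrm (v (X τ)) ^ 2 := by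
      simp only [hF, gDualN_sq, gInner, Finset.mul_sum, ← Finset.sum_sub_distrib,
        ← Finset.sum_add_distrib]
      refine Finset.sum_le_sum fun i _ => ?_
      have h := fenchelCoupling_step_le (hXconv i) (hnrm0 i) (hnrmS i) (hnrmT i) hKpos (hKle i)
        (hψsc i) (a := v (X τ) i) (e := ξ (τ + 1) i) (w := At (Λ τ) i) (x := x i)
        (hΦmem i (Y τ i)) (hΦmem i (Y (τ + 1) i)) (hΦmax i (Y τ i)) (hγ τ).le (hβ τ)
      have hYi : Y (τ + 1) i =
          Y τ i + γ τ • (v (X τ) i + ξ (τ + 1) i - β τ • At (Λ τ) i) := by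
        rw [hY]; rfl
      rw [← hYi] at h
      rw [Pi.sub_apply, hX τ i]
      exact h
    have hw : gDualN nrm (At (Λ τ)) ^ 2 ≤ C₁ ^ 2 * (Λ τ ⬝ᵥ Λ τ) := by
      have hnn : 0 ≤ Λ τ ⬝ᵥ Λ τ := Finset.sum_nonneg fun _ _ => mul_self_nonneg _
      rw [← Real.sq_sqrt hnn, ← mul_pow]
      exact pow_le_pow_left₀ (Real.sqrt_nonneg _) (hC₁ _ (hΛnn τ)) 2
    have hv : gDualN nrm (v (X τ)) ^ 2 ≤ C₂ ^ 2 :=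
      pow_le_pow_left₀ (Real.sqrt_nonneg _) (hC₂ _ fun i => hX τ i ▸ hΦmem i _) 2
    have hw' := mul_le_mul_of_nonneg_left hw
      (show 0 ≤ β τ ^ 2 * γ τ ^ 2 / K by positivity)
    have hv' := mul_le_mul_of_nonneg_left hv (show 0 ≤ 2 / K * γ τ ^ 2 by positivity)
    have e1 : β τ ^ 2 * γ τ ^ 2 * C₁ ^ 2 / K * (Λ τ ⬝ᵥ Λ τ)
        = β τ ^ 2 * γ τ ^ 2 / K * (C₁ ^ 2 * (Λ τ ⬝ᵥ Λ τ)) := by ring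
    have e2 : 2 * C₂ ^ 2 / K * γ τ ^ 2 = 2 / K * γ τ ^ 2 * C₂ ^ 2 := by ring
    rw [e1, e2]
    linarith
  rw [← Finset.sum_range_sub (fun τ => F x (Y τ)), Finset.mul_sum, Finset.mul_sum,
    ← Finset.sum_sub_distrib, ← Finset.sum_add_distrib, ← Finset.sum_add_distrib,
    ← Finset.sum_add_distrib, ← Finset.sum_add_distrib]
  exact Finset.sum_le_sum fun τ _ => hstep τ
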